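/- Let d ≥ 1 and let V : ℝ^d → ℝ be C² with Z_V := ∫ e^{−V} < ∞, ∇²V(x) ⪯ β I_d for all x (β > 0), and μ(0) > 0 where μ = e^{−V}/Z_V. Let p_s^V denote the forward Ornstein–Uhlenbeck density started at μ. Then for every t > 0, ∫_0^t ‖∇ log p_s^V(0)‖² ds ≤ −log μ(0) + (d/2) log(β/(2π)). -/

import Mathlib

open Real MeasureTheory
open scoped RealInnerProductSpace

/-- The forward Ornstein–Uhlenbeck density at time `s`, started at `μ = e^{-W}/∫ e^{-W}`. -/
noncomputable def ouDensity (d : ℕ) (W : EuclideanSpace ℝ (Fin d) → ℝ) (s : ℝ)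
    (z : EuclideanSpace ℝ (Fin d)) : ℝ :=
  (2 * π * (1 - exp (-2 * s))) ^ (-(d : ℝ) / 2) *
    ∫ x : EuclideanSpace ℝ (Fin d),
      exp (-‖z - exp (-s) • x‖ ^ 2 / (2 * (1 - exp (-2 * s)))) *
        (exp (-W x) / ∫ y : EuclideanSpace ℝ (Fin d), exp (-W y))

open ProbabilityTheory Filter Topology

section

variable {E : Type*} [NormedAddCommGroup E] [InnerProductSpace ℝ E]

/-- An upper bound on the Hessian bounds the symmetric second difference. -/
lemma add_sub_le_of_iteratedFDeriv_two_le {V : E → ℝ} (hV : ContDiff ℝ 2 V) {β : ℝ}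
    (hhess : ∀ x v : E, iteratedFDeriv ℝ 2 V x ![v, v] ≤ β * ‖v‖ ^ 2) (y v : E) :
    V (y + v) + V (y - v) ≤ 2 * V y + β * ‖v‖ ^ 2 := by
  have hline (r : ℝ) : HasDerivAt (fun r : ℝ => y + r • v) v r := by
    simpa using ((hasDerivAt_id r).smul_const v).const_add y
  have h1 (r : ℝ) : HasDerivAt (fun r : ℝ => V (y + r • v)) (fderiv ℝ V (y + r • v) v) r :=
    ((hV.differentiable (by norm_num)) _).hasFDerivAt.comp_hasDerivAt r (hline r)
  have hV1 : Differentiable ℝ (fderiv ℝ V) :=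
    (hV.fderiv_right (m := 1) (by norm_num)).differentiable (by norm_num)
  have h2 (r : ℝ) : HasDerivAt (fun r : ℝ => fderiv ℝ V (y + r • v) v)
      (fderiv ℝ (fderiv ℝ V) (y + r • v) v v) r := by
    simpa using ((hV1 _).hasFDerivAt.comp_hasDerivAt r (hline r)).clm_apply (hasDerivAt_const r v)
  have hf1 (r : ℝ) : HasDerivAt (fun r : ℝ => V (y + r • v) - β * ‖v‖ ^ 2 / 2 * r ^ 2)
      (fderiv ℝ V (y + r • v) v - β * ‖v‖ ^ 2 * r) r := by
    convert! (h1 r).sub ((hasDerivAt_pow 2 r).const_mul (β * ‖v‖ ^ 2 / 2)) using 1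
    norm_num; ring
  have hf2 (r : ℝ) : HasDerivAt (fun r : ℝ => fderiv ℝ V (y + r • v) v - β * ‖v‖ ^ 2 * r)
      (fderiv ℝ (fderiv ℝ V) (y + r • v) v v - β * ‖v‖ ^ 2) r := by
    convert! (h2 r).sub ((hasDerivAt_id r).const_mul (β * ‖v‖ ^ 2)) using 1
    ring
  have hderiv : deriv (fun r : ℝ => V (y + r • v) - β * ‖v‖ ^ 2 / 2 * r ^ 2) =
      fun r => fderiv ℝ V (y + r • v) v - β * ‖v‖ ^ 2 * r := funext fun r => (hf1 r).deriv
  have hconc := concaveOn_univ_of_deriv2_nonpos (fun r => (hf1 r).differentiableAt)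
    (by rw [hderiv]; exact fun r => (hf2 r).differentiableAt)
    (fun r => by
      rw [Function.iterate_succ, Function.iterate_one, Function.comp_apply, hderiv, (hf2 r).deriv]
      have := hhess (y + r • v) v
      rw [iteratedFDeriv_two_apply] at this
      simpa using this)
  obtain ⟨-, hmid⟩ := hconc
  have := hmid (Set.mem_univ 1) (Set.mem_univ (-1)) (a := 1 / 2) (b := 1 / 2)
    (by norm_num) (by norm_num) (by norm_num)
  norm_num at this
  rw [← sub_eq_add_neg] at this
  linarith

end

/-- Cauchy–Schwarz for integrals of exponentials, in logarithmic form. -/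
lemma log_integral_exp_add_le {α : Type*} [MeasurableSpace α] {m : Measure α} (hm : m ≠ 0)
    {f₁ f₂ g : α → ℝ} (h₁ : Integrable (fun x => exp (f₁ x)) m)
    (h₂ : Integrable (fun x => exp (f₂ x)) m) (hg : Integrable (fun x => exp (g x)) m)
    {c : ℝ} (h : ∀ x, 2 * g x + 2 * c ≤ f₁ x + f₂ x) :
    2 * log (∫ x, exp (g x) ∂m) + 2 * c ≤
      log (∫ x, exp (f₁ x) ∂m) + log (∫ x, exp (f₂ x) ∂m) := by
  have : NeZero m := ⟨hm⟩
  have p₁ := integral_exp_pos h₁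
  have p₂ := integral_exp_pos h₂
  have pg := integral_exp_pos hg
  set A := ∫ x, exp (f₁ x) ∂m
  set B := ∫ x, exp (f₂ x) ∂m
  have key : 2 * exp (c - (log A + log B) / 2) * ∫ x, exp (g x) ∂m ≤ A * A⁻¹ + B * B⁻¹ := by
    rw [← integral_const_mul, ← integral_mul_const, ← integral_mul_const, ← integral_add
      (h₁.mul_const _) (h₂.mul_const _)]
    refine integral_mono (hg.const_mul _) ((h₁.mul_const _).add (h₂.mul_const _)) fun x => ?_
    have e₁ : exp (f₁ x) * A⁻¹ = exp ((f₁ x - log A) / 2) ^ 2 := by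
      rw [← exp_nat_mul]; push_cast
      rw [show 2 * ((f₁ x - log A) / 2) = f₁ x - log A by ring, exp_sub, exp_log p₁, div_eq_mul_inv]
    have e₂ : exp (f₂ x) * B⁻¹ = exp ((f₂ x - log B) / 2) ^ 2 := by
      rw [← exp_nat_mul]; push_cast
      rw [show 2 * ((f₂ x - log B) / 2) = f₂ x - log B by ring, exp_sub, exp_log p₂, div_eq_mul_inv]
    have e₃ : exp (c - (log A + log B) / 2) * exp (g x) ≤
        exp ((f₁ x - log A) / 2) * exp ((f₂ x - log B) / 2) := by
      rw [← exp_add, ← exp_add]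
      exact exp_le_exp.2 (by linarith [h x])
    simp only [e₁, e₂]
    nlinarith [sq_nonneg (exp ((f₁ x - log A) / 2) - exp ((f₂ x - log B) / 2))]
  rw [mul_inv_cancel₀ p₁.ne', mul_inv_cancel₀ p₂.ne'] at key
  have : exp (c - (log A + log B) / 2 + log (∫ x, exp (g x) ∂m)) ≤ exp 0 := by
    rw [exp_add, exp_log pg, exp_zero]; linarith
  linarith [exp_le_exp.1 this]

/-- A lower bound on symmetric second differences bounds the second derivative from below. -/
lemma le_deriv_deriv_of_le_add_neg {f : ℝ → ℝ} (hf : ContDiff ℝ 2 f) {K : ℝ}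
    (h : ∀ r, K * r ^ 2 ≤ f r + f (-r) - 2 * f 0) : K ≤ deriv (deriv f) 0 := by
  by_contra! hK
  have hf1 : Differentiable ℝ f := hf.differentiable (by norm_num)
  have hf2 : Differentiable ℝ (deriv f) := by
    have := hf.iterate_deriv' 1 1
    exact this.differentiable (by norm_num)
  set q : ℝ → ℝ := fun r => f r + f (-r) - 2 * f 0 - K * r ^ 2 with hq
  have d1 (r : ℝ) : HasDerivAt q (deriv f r - deriv f (-r) - 2 * K * r) r := by
    have := (((hf1 r).hasDerivAt.add ((hf1 (-r)).hasDerivAt.comp r (hasDerivAt_neg r))).sub_const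
      (2 * f 0)).sub ((hasDerivAt_pow 2 r).const_mul K)
    convert! this using 1
    norm_num; ring
  have hdq : deriv q = fun r => deriv f r - deriv f (-r) - 2 * K * r :=
    funext fun r => (d1 r).deriv
  have d2 : HasDerivAt (deriv q) (2 * deriv (deriv f) 0 - 2 * K) 0 := by
    rw [hdq]
    have hneg : HasDerivAt (deriv f) (deriv (deriv f) (-0)) (-0) := (hf2 (-0)).hasDerivAt
    have := ((hf2 0).hasDerivAt.sub (hneg.comp (0 : ℝ) (hasDerivAt_neg 0))).sub
      ((hasDerivAt_id (0 : ℝ)).const_mul (2 * K))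
    convert! this using 1
    norm_num; ring
  have hmax := isLocalMax_of_deriv_deriv_neg (f := q) (x₀ := 0)
    (by rw [d2.deriv]; linarith) (by simp [hdq]) (d1 0).continuousAt
  have hq0 : q 0 = 0 := by simp [hq]; ring
  have hzero : q =ᶠ[𝓝 0] fun _ => 0 := by
    filter_upwards [hmax] with r hr
    exact le_antisymm (hr.trans_eq hq0) (by simp only [hq]; linarith [h r])
  have := hzero.deriv.deriv_eq
  rw [d2.deriv] at this
  simp at this
  linarith

/-- A nondecreasing function on `(0, t]` bounded below by `L` has total derivative at most
`H t - L`. -/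
lemma lintegral_Ioc_ofReal_deriv_le {H H' : ℝ → ℝ} (hd : ∀ s, 0 < s → HasDerivAt H (H' s) s)
    (hc : ContinuousOn H' (Set.Ioi 0)) (hn : ∀ s, 0 < s → 0 ≤ H' s) {L : ℝ}
    (hL : ∀ s, 0 < s → L ≤ H s) {t : ℝ} (ht : 0 < t) :
    ∫⁻ s in Set.Ioc 0 t, ENNReal.ofReal (H' s) ≤ ENNReal.ofReal (H t - L) := by
  have hm : AEMeasurable (fun s => ENNReal.ofReal (H' s)) (volume.restrict (Set.Ioc 0 t)) :=
    ((hc.mono fun s hs => hs.1).aemeasurable measurableSet_Ioc).ennreal_ofReal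
  have ha : Tendsto (fun n : ℕ => t / ((n : ℝ) + 1)) atTop (𝓝 0) :=
    tendsto_const_nhds.div_atTop (tendsto_natCast_atTop_atTop.atTop_add tendsto_const_nhds)
  refine le_of_tendsto ((aecover_Ioc_of_Ioc (μ := volume) ha
    (tendsto_const_nhds (x := t))).lintegral_tendsto_of_countably_generated hm)
    (Eventually.of_forall fun n => ?_)
  have hpos : 0 < t / ((n : ℝ) + 1) := by positivity
  have hle : t / ((n : ℝ) + 1) ≤ t := div_le_self ht.le (by linarith [n.cast_nonneg (α := ℝ)])
  have hcont : ContinuousOn H' (Set.uIcc (t / ((n : ℝ) + 1)) t) := by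
    rw [Set.uIcc_of_le hle]
    exact hc.mono fun s hs => hpos.trans_le hs.1
  rw [Measure.restrict_restrict measurableSet_Ioc, Set.inter_eq_left.2
    (Set.Ioc_subset_Ioc_left hpos.le), ← ofReal_integral_eq_lintegral_ofReal,
    ← intervalIntegral.integral_of_le hle, intervalIntegral.integral_eq_sub_of_hasDerivAt
      (fun s hs => hd s ?_) hcont.intervalIntegrable]
  · exact ENNReal.ofReal_le_ofReal (by linarith [hL _ hpos])
  · rw [Set.uIcc_of_le hle] at hs
    exact hpos.trans_le hs.1
  · exact hcont.intervalIntegrable.1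
  · exact (ae_restrict_iff' measurableSet_Ioc).2 (ae_of_all _ fun s hs => hn s (hpos.trans hs.1))

/-- The potential `V` with a quadratic confinement of strength `a` added. -/
noncomputable def confined {E : Type*} [NormedAddCommGroup E] (V : E → ℝ) (a : ℝ) (x : E) : ℝ :=
  V x + a / 2 * ‖x‖ ^ 2

lemma continuous_confined {E : Type*} [NormedAddCommGroup E] {V : E → ℝ}
    (hV : Continuous V) (a : ℝ) : Continuous (confined V a) := by
  unfold confined; fun_prop

lemma confined_add_sub_le {E : Type*} [NormedAddCommGroup E] [InnerProductSpace ℝ E]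
    {V : E → ℝ} {β : ℝ}
    (hmid : ∀ y v, V (y + v) + V (y - v) ≤ 2 * V y + β * ‖v‖ ^ 2) (a : ℝ) (y v : E) :
    confined V a (y + v) + confined V a (y - v) ≤ 2 * confined V a y + (β + a) * ‖v‖ ^ 2 := by
  have := parallelogram_law_with_norm ℝ y v
  have h := hmid y v
  unfold confined
  linear_combination h + a / 2 * this

section

variable {E : Type*} [NormedAddCommGroup E] [InnerProductSpace ℝ E] [FiniteDimensional ℝ E]
  [MeasurableSpace E] [BorelSpace E]

/-- The measure with density `e^{-U}` with respect to Lebesgue measure. -/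
noncomputable def boltzmannMeasure (U : E → ℝ) : Measure E :=
  volume.withDensity fun x => ENNReal.ofReal (exp (-U x))

lemma integral_boltzmannMeasure {U : E → ℝ} (hU : Continuous U) (f : E → ℝ) :
    ∫ x, f x ∂boltzmannMeasure U = ∫ x, exp (-U x) * f x := by
  rw [boltzmannMeasure, integral_withDensity_eq_integral_toReal_smul (by fun_prop)
    (ae_of_all _ fun _ => ENNReal.ofReal_lt_top)]
  simp [ENNReal.toReal_ofReal (exp_pos _).le]

lemma integrable_boltzmannMeasure_iff {U : E → ℝ} (hU : Continuous U) {f : E → ℝ} :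
    Integrable f (boltzmannMeasure U) ↔ Integrable fun x => exp (-U x) * f x := by
  rw [boltzmannMeasure, integrable_withDensity_iff_integrable_smul' (by fun_prop)
    (ae_of_all _ fun _ => ENNReal.ofReal_lt_top)]
  simp [ENNReal.toReal_ofReal (exp_pos _).le]

lemma mgf_boltzmannMeasure {U : E → ℝ} (hU : Continuous U) (X : E → ℝ) (r : ℝ) :
    mgf X (boltzmannMeasure U) r = ∫ x, exp (r * X x - U x) := by
  rw [mgf, integral_boltzmannMeasure hU]
  simp_rw [← exp_add]
  congr! 3
  ring

lemma mem_integrableExpSet_boltzmannMeasure {U : E → ℝ} (hU : Continuous U) (X : E → ℝ) {r : ℝ} :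
    r ∈ integrableExpSet X (boltzmannMeasure U) ↔ Integrable fun x => exp (r * X x - U x) := by
  rw [integrableExpSet, Set.mem_ofPred_eq, integrable_boltzmannMeasure_iff hU]
  simp_rw [← exp_add]
  congr! 3
  ring

lemma integrableExpSet_inner_eq_univ {U : E → ℝ} (hU : Continuous U)
    (hint : ∀ θ : E, Integrable fun x => exp (⟪θ, x⟫ - U x)) (e : E) :
    integrableExpSet (fun x => ⟪e, x⟫) (boltzmannMeasure U) = Set.univ := by
  refine Set.eq_univ_of_forall fun r => (mem_integrableExpSet_boltzmannMeasure hU _).2 ?_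
  simpa [real_inner_smul_left] using hint (r • e)

/-- Reverse Poincaré (Cramér–Rao) inequality for linear functionals: if `e^{-U}` is
`κ`-semi-log-convex, its covariance is bounded below by `κ⁻¹`. -/
lemma sq_norm_div_le_variance_inner {U : E → ℝ} (hU : Continuous U)
    (hint : ∀ θ : E, Integrable fun x => exp (⟪θ, x⟫ - U x)) {κ : ℝ} (hκ : 0 < κ)
    (hmid : ∀ y v, U (y + v) + U (y - v) ≤ 2 * U y + κ * ‖v‖ ^ 2) (e : E) :
    ‖e‖ ^ 2 / κ ≤ (∫ x, ⟪e, x⟫ ^ 2 ∂boltzmannMeasure U) / (boltzmannMeasure U).real Set.univ -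
      ((∫ x, ⟪e, x⟫ ∂boltzmannMeasure U) / (boltzmannMeasure U).real Set.univ) ^ 2 := by
  have huniv := integrableExpSet_inner_eq_univ hU hint e
  have hmem (r : ℝ) : r ∈ interior (integrableExpSet (fun x => ⟪e, x⟫) (boltzmannMeasure U)) := by
    rw [huniv]; simp
  set c := cgf (fun x => ⟪e, x⟫) (boltzmannMeasure U) with hc
  have hsmooth : ContDiff ℝ 2 c :=
    contDiff_iff_contDiffAt.2 fun r => (analyticAt_cgf (hmem r)).contDiffAt
  have htheta (θ : E) : 2 * log (∫ x, exp (-U x)) + ‖θ‖ ^ 2 / κ ≤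
      log (∫ x, exp (⟪θ, x⟫ - U x)) + log (∫ x, exp (⟪-θ, x⟫ - U x)) := by
    rw [← integral_add_right_eq_self (fun x => exp (⟪θ, x⟫ - U x)) (κ⁻¹ • θ),
      ← integral_sub_right_eq_self (fun x => exp (⟪-θ, x⟫ - U x)) (κ⁻¹ • θ)]
    have h0 : Integrable fun x => exp (-U x) := by simpa using hint 0
    have := log_integral_exp_add_le (m := (volume : Measure E)) (NeZero.ne _)
      ((hint θ).comp_add_right (κ⁻¹ • θ)) ((hint (-θ)).comp_sub_right (κ⁻¹ • θ)) h0
      (c := ‖θ‖ ^ 2 / κ / 2) fun x => ?_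
    · linarith
    · have := hmid x (κ⁻¹ • θ)
      have e1 : κ * ‖κ⁻¹ • θ‖ ^ 2 = ‖θ‖ ^ 2 / κ := by
        rw [norm_smul, mul_pow, norm_inv, norm_eq_abs, inv_pow, sq_abs]; field_simp
      rw [e1] at this
      have e2 : ‖θ‖ ^ 2 / κ = κ⁻¹ * ‖θ‖ ^ 2 := by rw [div_eq_inv_mul]
      simp only [inner_add_right, inner_sub_right, inner_neg_left, inner_smul_right,
        real_inner_self_eq_norm_sq]
      linarith
  have hcr (r : ℝ) : c r = log (∫ x, exp (⟪r • e, x⟫ - U x)) := by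
    rw [hc, cgf, mgf_boltzmannMeasure hU]; simp [real_inner_smul_left]
  have hsecond := le_deriv_deriv_of_le_add_neg hsmooth (K := ‖e‖ ^ 2 / κ) fun r => by
    have := htheta (r • e)
    rw [hcr, hcr, hcr, zero_smul, neg_smul]
    simp only [inner_zero_left, zero_sub]
    rw [norm_smul, mul_pow, norm_eq_abs, sq_abs] at this
    have e3 : ‖e‖ ^ 2 / κ * r ^ 2 = r ^ 2 * ‖e‖ ^ 2 / κ := by ring
    linarith
  have hvar := iteratedDeriv_two_cgf (hmem 0)
  rw [iteratedDeriv_succ, iteratedDeriv_one, deriv_cgf_zero (hmem 0)] at hvar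
  rw [← hc] at hvar
  rw [hvar] at hsecond
  simpa [mgf_zero'] using hsecond

variable {V : E → ℝ}

lemma integrable_exp_inner_sub_confined (hV : Continuous V)
    (hint : Integrable fun x => exp (-V x)) {a : ℝ} (ha : 0 < a) (θ : E) :
    Integrable fun x => exp (⟪θ, x⟫ - confined V a x) := by
  refine (hint.const_mul (exp (‖θ‖ ^ 2 / (2 * a)))).mono'
    (by have := continuous_confined hV a; fun_prop) (ae_of_all _ fun x => ?_)
  rw [norm_of_nonneg (exp_pos _).le, ← exp_add, exp_le_exp, confined]
  have h1 := real_inner_le_norm θ x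
  have h2 : ‖θ‖ ^ 2 / (2 * a) - ‖θ‖ * ‖x‖ + a / 2 * ‖x‖ ^ 2 = (‖θ‖ - a * ‖x‖) ^ 2 / (2 * a) := by
    field_simp; ring
  have h3 : 0 ≤ (‖θ‖ - a * ‖x‖) ^ 2 / (2 * a) := by positivity
  linarith

lemma confined_mem_interior (hV : Continuous V) (hint : Integrable fun x => exp (-V x)) {a : ℝ}
    (ha : 0 < a) :
    a ∈ interior (integrableExpSet (fun x : E => -(‖x‖ ^ 2 / 2)) (boltzmannMeasure V)) := by
  refine mem_interior.2 ⟨Set.Ioi 0, fun b hb => ?_, isOpen_Ioi, ha⟩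
  rw [mem_integrableExpSet_boltzmannMeasure hV]
  have := integrable_exp_inner_sub_confined hV hint hb 0
  simp only [inner_zero_left, confined] at this
  convert! this using 3
  ring

lemma real_univ_boltzmannMeasure {U : E → ℝ} (hU : Continuous U) :
    (boltzmannMeasure U).real Set.univ = ∫ x, exp (-U x) := by
  have := integral_boltzmannMeasure hU fun _ => 1
  simpa using this

lemma mgf_sq_norm_boltzmannMeasure (hV : Continuous V) (a : ℝ) :
    mgf (fun x : E => -(‖x‖ ^ 2 / 2)) (boltzmannMeasure V) a =
      (boltzmannMeasure (confined V a)).real Set.univ := by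
  rw [mgf_boltzmannMeasure hV, real_univ_boltzmannMeasure (continuous_confined hV a)]
  congr! 3
  unfold confined
  ring

/-- The derivative of the log-partition function in the confinement strength. -/
lemma deriv_cgf_sq_norm_le {d : ℕ} {V : EuclideanSpace ℝ (Fin d) → ℝ} (hV : Continuous V)
    (hint : Integrable fun x => exp (-V x)) {β : ℝ} (hβ : 0 < β)
    (hmid : ∀ y v, V (y + v) + V (y - v) ≤ 2 * V y + β * ‖v‖ ^ 2) {a : ℝ} (ha : 0 < a) :
    deriv (cgf (fun x : EuclideanSpace ℝ (Fin d) => -(‖x‖ ^ 2 / 2)) (boltzmannMeasure V)) a +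
      d / 2 / (β + a) ≤
    -(1 / 2) * ∑ i, ((∫ x, ⟪EuclideanSpace.basisFun (Fin d) ℝ i, x⟫ ∂boltzmannMeasure (confined V a)) /
      (boltzmannMeasure (confined V a)).real Set.univ) ^ 2 := by
  have hU := continuous_confined hV a
  have hI := integrable_exp_inner_sub_confined hV hint ha
  rw [deriv_cgf (confined_mem_interior hV hint ha), mgf_sq_norm_boltzmannMeasure hV]
  set b := EuclideanSpace.basisFun (Fin d) ℝ
  set N := (boltzmannMeasure (confined V a)).real Set.univ
  have hnum : ∫ x : EuclideanSpace ℝ (Fin d),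
      -(‖x‖ ^ 2 / 2) * exp (a * -(‖x‖ ^ 2 / 2)) ∂boltzmannMeasure V =
      -(1 / 2) * ∑ i, ∫ x, ⟪b i, x⟫ ^ 2 ∂boltzmannMeasure (confined V a) := by
    rw [← integral_finsetSum, integral_boltzmannMeasure hV, integral_boltzmannMeasure hU,
      ← integral_const_mul]
    · refine integral_congr_ae (ae_of_all _ fun x => ?_)
      dsimp only
      have : exp (-confined V a x) = exp (-V x) * exp (a * -(‖x‖ ^ 2 / 2)) := by
        rw [← exp_add, confined]; congr 1; ring
      rw [b.sum_sq_inner_right x, this]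
      ring
    · intro i _
      refine integrable_pow_of_mem_interior_integrableExpSet ?_ 2
      rw [integrableExpSet_inner_eq_univ hU hI]; simp
  have hsum : ∑ i : Fin d, 1 / (β + a) ≤ ∑ i, ((∫ x, ⟪b i, x⟫ ^ 2 ∂boltzmannMeasure (confined V a)) / N -
      ((∫ x, ⟪b i, x⟫ ∂boltzmannMeasure (confined V a)) / N) ^ 2) :=
    Finset.sum_le_sum fun i _ => by
      have := sq_norm_div_le_variance_inner hU hI (add_pos hβ ha) (confined_add_sub_le hmid a) (b i)
      rwa [b.norm_eq_one, one_pow] at this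
  rw [hnum]
  rw [Finset.sum_sub_distrib, Finset.sum_const, Finset.card_univ,
    Fintype.card_fin, nsmul_eq_mul] at hsum
  have e1 : (d : ℝ) / 2 / (β + a) = 1 / 2 * (d * (1 / (β + a))) := by ring
  rw [e1, mul_div_assoc, Finset.sum_div]
  linarith

end

/-- Along a line through the origin, `log p_s` is a quadratic plus a cumulant-generating function. -/
lemma log_ouDensity_smul {d : ℕ} {V : EuclideanSpace ℝ (Fin d) → ℝ} (hV : Continuous V)
    (hint : Integrable fun x => exp (-V x)) {s : ℝ} (hs : 0 < s) (e : EuclideanSpace ℝ (Fin d))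
    (r : ℝ) :
    log (ouDensity d V s (r • e)) =
      log ((2 * π * (1 - exp (-2 * s))) ^ (-(d : ℝ) / 2) / ∫ x, exp (-V x)) +
      -(‖e‖ ^ 2 / (2 * (1 - exp (-2 * s)))) * r ^ 2 +
      cgf (fun x => ⟪e, x⟫) (boltzmannMeasure (confined V (exp (-2 * s) / (1 - exp (-2 * s)))))
        (exp (-s) / (1 - exp (-2 * s)) * r) := by
  have hσ : 0 < 1 - exp (-2 * s) := by rw [sub_pos, exp_lt_one_iff]; linarith
  have hsq : exp (-2 * s) = exp (-s) ^ 2 := by rw [← exp_nat_mul]; congr 1; push_cast; ring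
  set σ := 1 - exp (-2 * s)
  have ha : 0 < exp (-2 * s) / σ := by positivity
  have hU := continuous_confined hV (exp (-2 * s) / σ)
  have hZ : 0 < ∫ x, exp (-V x) := integral_exp_pos hint
  have hC : 0 < (2 * π * σ) ^ (-(d : ℝ) / 2) := by positivity
  have hI : Integrable fun x =>
      exp (exp (-s) / σ * r * ⟪e, x⟫ - confined V (exp (-2 * s) / σ) x) := by
    simpa [real_inner_smul_left] using
      integrable_exp_inner_sub_confined hV hint ha ((exp (-s) / σ * r) • e)
  rw [cgf, mgf_boltzmannMeasure hU, add_assoc, ← log_exp (-(‖e‖ ^ 2 / (2 * σ)) * r ^ 2),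
    ← log_mul (exp_pos _).ne' (integral_exp_pos hI).ne', ← log_mul (by positivity)
    (mul_pos (exp_pos _) (integral_exp_pos hI)).ne']
  congr 1
  unfold ouDensity
  rw [show 1 - exp (-2 * s) = σ from rfl]
  rw [div_mul_eq_mul_div, mul_div_assoc]
  congr 1
  rw [← integral_const_mul, ← integral_div]
  refine integral_congr_ae (ae_of_all _ fun x => ?_)
  dsimp only
  rw [← mul_div_assoc, ← exp_add, ← exp_add]
  congr 2
  rw [norm_sub_sq_real, norm_smul, norm_smul, mul_pow, mul_pow, norm_eq_abs, norm_eq_abs, sq_abs,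
    sq_abs, real_inner_smul_left, real_inner_smul_right, confined, hsq]
  field_simp
  ring

lemma sq_norm_gradient_log_ouDensity_le {d : ℕ} {V : EuclideanSpace ℝ (Fin d) → ℝ}
    (hV : Continuous V) (hint : Integrable fun x => exp (-V x)) {s : ℝ} (hs : 0 < s) {a : ℝ}
    (has : a = exp (-2 * s) / (1 - exp (-2 * s))) :
    ‖gradient (fun w => log (ouDensity d V s w)) 0‖ ^ 2 ≤
      exp (-2 * s) / (1 - exp (-2 * s)) ^ 2 *
      ∑ i, ((∫ x, ⟪EuclideanSpace.basisFun (Fin d) ℝ i, x⟫ ∂boltzmannMeasure (confined V a)) /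
        (boltzmannMeasure (confined V a)).real Set.univ) ^ 2 := by
  set f := fun w => log (ouDensity d V s w)
  set b := EuclideanSpace.basisFun (Fin d) ℝ
  by_cases hdiff : DifferentiableAt ℝ f 0
  swap
  · rw [gradient_eq_zero_of_not_differentiableAt hdiff]
    simp only [norm_zero, ne_eq, OfNat.ofNat_ne_zero, not_false_eq_true, zero_pow]
    positivity
  have hσ : 0 < 1 - exp (-2 * s) := by rw [sub_pos, exp_lt_one_iff]; linarith
  have hsq : exp (-2 * s) = exp (-s) ^ 2 := by rw [← exp_nat_mul]; congr 1; push_cast; ring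
  have ha : 0 < a := by rw [has]; positivity
  have hU := continuous_confined hV a
  have hI := integrable_exp_inner_sub_confined hV hint ha
  rw [← b.sum_sq_inner_right (gradient f 0), Finset.mul_sum]
  refine (Finset.sum_congr rfl fun i _ => ?_).le
  have hmem : (0 : ℝ) ∈ interior (integrableExpSet (fun x => ⟪b i, x⟫)
      (boltzmannMeasure (confined V a))) := by
    rw [integrableExpSet_inner_eq_univ hU hI]; simp
  have h1 : HasDerivAt (fun r : ℝ => f (r • b i)) ⟪b i, gradient f 0⟫ 0 := by
    have hg : HasFDerivAt f (fderiv ℝ f 0) ((0 : ℝ) • b i) := by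
      rw [zero_smul]; exact hdiff.hasFDerivAt
    have := hg.comp_hasDerivAt (0 : ℝ) ((hasDerivAt_id (0 : ℝ)).smul_const (b i))
    rw [one_smul] at this
    convert! this using 1
    rw [real_inner_comm, gradient, InnerProductSpace.toDual_symm_apply]
  set k := exp (-s) / (1 - exp (-2 * s)) with hk
  have h2 : HasDerivAt (fun r : ℝ => f (r • b i))
      (k * ((∫ x, ⟪b i, x⟫ ∂boltzmannMeasure (confined V a)) /
        (boltzmannMeasure (confined V a)).real Set.univ)) 0 := by
    have hfun : (fun r : ℝ => f (r • b i)) = _ :=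
      funext fun r => log_ouDensity_smul hV hint hs (b i) r
    rw [hfun, ← has, ← hk, ← deriv_cgf_zero hmem]
    have hc := (analyticAt_cgf hmem).differentiableAt.hasDerivAt
    rw [← mul_zero k] at hc
    have := (((hasDerivAt_pow 2 (0 : ℝ)).const_mul
      (-(‖b i‖ ^ 2 / (2 * (1 - exp (-2 * s)))))).const_add
      (log ((2 * π * (1 - exp (-2 * s))) ^ (-(d : ℝ) / 2) / ∫ x, exp (-V x)))).add
      (hc.comp (0 : ℝ) ((hasDerivAt_id (0 : ℝ)).const_mul k))
    convert! this using 1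
    simp [mul_comm]
  rw [h1.unique h2, mul_pow, hk, div_pow, hsq]

/-- The partition function of the confined measure is bounded below by its Gaussian value. -/
lemma le_cgf_sq_norm_add {d : ℕ} {V : EuclideanSpace ℝ (Fin d) → ℝ} (hV : Continuous V)
    (hint : Integrable fun x => exp (-V x)) {β : ℝ} (hβ : 0 < β)
    (hmid : ∀ y v, V (y + v) + V (y - v) ≤ 2 * V y + β * ‖v‖ ^ 2) {a : ℝ} (ha : 0 < a) :
    -V 0 + d / 2 * log (2 * π) ≤
      cgf (fun x : EuclideanSpace ℝ (Fin d) => -(‖x‖ ^ 2 / 2)) (boltzmannMeasure V) a +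
        d / 2 * log (β + a) := by
  have hβa : 0 < (β + a) / 2 := by positivity
  have hg : Integrable fun x : EuclideanSpace ℝ (Fin d) => exp (-((β + a) / 2) * ‖x‖ ^ 2) := by
    by_contra h
    have h0 := GaussianFourier.integral_rexp_neg_mul_sq_norm
      (V := EuclideanSpace ℝ (Fin d)) hβa
    rw [integral_undef h] at h0
    exact (rpow_pos_of_pos (by positivity) _).ne h0
  have h1 : Integrable fun x => exp (-confined V a x) := by
    simpa using integrable_exp_inner_sub_confined hV hint ha 0
  have h := log_integral_exp_add_le (NeZero.ne _) h1 h1.comp_neg hg (c := -V 0) fun x => by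
    have h2 := confined_add_sub_le hmid a 0 x
    have h3 : confined V a 0 = V 0 := by simp [confined]
    rw [zero_add, zero_sub, h3] at h2
    linarith
  rw [integral_neg_eq_self (fun x => exp (-confined V a x)),
    GaussianFourier.integral_rexp_neg_mul_sq_norm hβa, finrank_euclideanSpace_fin,
    log_rpow (by positivity), show π / ((β + a) / 2) = 2 * π / (β + a) by field_simp,
    log_div (by positivity) (by positivity),
    ← real_univ_boltzmannMeasure (continuous_confined hV a), ← mgf_sq_norm_boltzmannMeasure hV] at h
  rw [cgf]
  linarith

lemma cgf_sq_norm_le {d : ℕ} {V : EuclideanSpace ℝ (Fin d) → ℝ} (hV : Continuous V)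
    (hint : Integrable fun x => exp (-V x)) {a : ℝ} (ha : 0 < a) :
    cgf (fun x : EuclideanSpace ℝ (Fin d) => -(‖x‖ ^ 2 / 2)) (boltzmannMeasure V) a ≤
      log (∫ x, exp (-V x)) := by
  have h1 : Integrable fun x => exp (-confined V a x) := by
    simpa using integrable_exp_inner_sub_confined hV hint ha 0
  rw [cgf, mgf_sq_norm_boltzmannMeasure hV, real_univ_boltzmannMeasure (continuous_confined hV a)]
  refine log_le_log (integral_exp_pos h1) (integral_mono h1 hint fun x => ?_)
  simp only [exp_le_exp, confined]
  have : 0 ≤ a / 2 * ‖x‖ ^ 2 := by positivity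
  linarith

/-- For `μ = e^{-V}/Z_V` `β`-semi-log-convex (`β > 0`) with `μ(0) > 0`, the
time-integrated squared score of the forward OU density at the origin satisfies, for `t > 0`,
`∫_0^t ‖∇ log p_s^V(0)‖² ds ≤ -log μ(0) + (d/2) log(β/(2π))`. -/
theorem integrated_score_at_zero_bound
    (d : ℕ) (hd : 1 ≤ d) (V : EuclideanSpace ℝ (Fin d) → ℝ)
    (hV : ContDiff ℝ 2 V)
    (hint : Integrable fun x : EuclideanSpace ℝ (Fin d) => exp (-V x))
    (hμ0 : 0 < exp (-V 0) / ∫ x : EuclideanSpace ℝ (Fin d), exp (-V x))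
    (β : ℝ) (hβ : 0 < β)
    (hhess : ∀ x v : EuclideanSpace ℝ (Fin d),
      iteratedFDeriv ℝ 2 V x ![v, v] ≤ β * ‖v‖ ^ 2)
    (t : ℝ) (ht : 0 < t) :
    ∫⁻ s in Set.Ioc (0 : ℝ) t,
        ENNReal.ofReal (‖gradient (fun w => Real.log (ouDensity d V s w)) 0‖ ^ 2) ≤
      ENNReal.ofReal
        (-Real.log (exp (-V 0) / ∫ x : EuclideanSpace ℝ (Fin d), exp (-V x)) +
          (d : ℝ) / 2 * Real.log (β / (2 * π))) := by
  have hVc := hV.continuous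
  have hmid := add_sub_le_of_iteratedFDeriv_two_le hV hhess
  have hZ : 0 < ∫ x, exp (-V x) := integral_exp_pos hint
  have hσ {s : ℝ} (hs : 0 < s) : 0 < 1 - exp (-2 * s) := by
    rw [sub_pos, exp_lt_one_iff]; linarith
  set a : ℝ → ℝ := fun s => exp (-2 * s) / (1 - exp (-2 * s))
  have hapos {s : ℝ} (hs : 0 < s) : 0 < a s := div_pos (exp_pos _) (hσ hs)
  set c := cgf (fun x : EuclideanSpace ℝ (Fin d) => -(‖x‖ ^ 2 / 2)) (boltzmannMeasure V)
  have hcan {s : ℝ} (hs : 0 < s) : AnalyticAt ℝ c s :=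
    analyticAt_cgf (confined_mem_interior hVc hint hs)
  set a' : ℝ → ℝ := fun s => -2 * exp (-2 * s) / (1 - exp (-2 * s)) ^ 2 with ha'
  have had {s : ℝ} (hs : 0 < s) : HasDerivAt a (a' s) s := by
    have h1 : HasDerivAt (fun s : ℝ => exp (-2 * s)) (-2 * exp (-2 * s)) s := by
      convert! ((hasDerivAt_id s).const_mul (-2)).exp using 1
      simp [mul_comm]
    convert! h1.div (h1.const_sub 1) (hσ hs).ne' using 1
    rw [ha']; ring
  set H : ℝ → ℝ := fun s => c (a s) + d / 2 * log (β + a s)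
  set H' : ℝ → ℝ := fun s => (deriv c (a s) + d / 2 / (β + a s)) * a' s with hH'
  have hHd (s : ℝ) (hs : 0 < s) : HasDerivAt H (H' s) s := by
    have hne : β + a s ≠ 0 := (add_pos hβ (hapos hs)).ne'
    convert! ((hcan (hapos hs)).differentiableAt.hasDerivAt.comp s (had hs)).add
      ((((had hs).const_add β).log hne).const_mul ((d : ℝ) / 2)) using 1
    rw [hH']; ring
  have hacont : ContinuousOn a (Set.Ioi 0) := fun s hs => (had hs).continuousAt.continuousWithinAt
  have hHc : ContinuousOn H' (Set.Ioi 0) := by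
    refine ContinuousOn.mul (ContinuousOn.add ?_ ?_) ?_
    · exact fun s hs => ((hcan (hapos hs)).deriv.continuousAt.comp
        (had hs).continuousAt).continuousWithinAt
    · exact continuousOn_const.div (continuousOn_const.add hacont)
        fun s hs => (add_pos hβ (hapos hs)).ne'
    · exact ContinuousOn.div (by fun_prop) (by fun_prop) fun s hs => pow_ne_zero 2 (hσ hs).ne'
  have hscore {s : ℝ} (hs : 0 < s) :
      ‖gradient (fun w => log (ouDensity d V s w)) 0‖ ^ 2 ≤ H' s := by
    refine (sq_norm_gradient_log_ouDensity_le hVc hint hs (a := a s) rfl).trans ?_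
    have h1 := deriv_cgf_sq_norm_le hVc hint hβ hmid (hapos hs)
    have h2 : 0 ≤ 2 * (exp (-2 * s) / (1 - exp (-2 * s)) ^ 2) := by positivity
    have h3 := mul_le_mul_of_nonneg_left h1 h2
    have h4 : a' s = -(2 * (exp (-2 * s) / (1 - exp (-2 * s)) ^ 2)) := by rw [ha']; ring
    simp only [hH', h4]
    linarith
  have hHn (s : ℝ) (hs : 0 < s) : 0 ≤ H' s := (sq_nonneg _).trans (hscore hs)
  have hmono : MonotoneOn H (Set.Ioi 0) := by
    refine monotoneOn_of_deriv_nonneg (convex_Ioi 0)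
      (fun s hs => (hHd s hs).continuousAt.continuousWithinAt) ?_ ?_ <;> rw [interior_Ioi]
    · exact fun s hs => (hHd s hs).differentiableAt.differentiableWithinAt
    · intro s hs
      rw [(hHd s hs).deriv]
      exact hHn s hs
  have hupper : H t ≤ log (∫ x, exp (-V x)) + d / 2 * log β := by
    have hexp : Tendsto (fun s : ℝ => exp (-2 * s)) atTop (𝓝 0) :=
      tendsto_exp_atBot.comp (tendsto_id.const_mul_atTop_of_neg (by norm_num))
    have hlim : Tendsto (fun s => log (∫ x, exp (-V x)) + d / 2 * log (β + a s)) atTop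
        (𝓝 (log (∫ x, exp (-V x)) + d / 2 * log β)) := by
      have h0 : Tendsto a atTop (𝓝 0) := by
        have := hexp.div (hexp.const_sub 1) (by norm_num)
        rwa [zero_div] at this
      have h1 : Tendsto (fun s => β + a s) atTop (𝓝 β) := by simpa using h0.const_add β
      exact ((h1.log hβ.ne').const_mul _).const_add _
    refine ge_of_tendsto hlim ((eventually_ge_atTop t).mono fun s hs => ?_)
    have hs0 := ht.trans_le hs
    refine (hmono ht hs0 hs).trans ?_
    simpa [H] using cgf_sq_norm_le hVc hint (hapos hs0)
  calc ∫⁻ s in Set.Ioc (0 : ℝ) t,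
        ENNReal.ofReal (‖gradient (fun w => log (ouDensity d V s w)) 0‖ ^ 2)
      ≤ ∫⁻ s in Set.Ioc (0 : ℝ) t, ENNReal.ofReal (H' s) :=
        setLIntegral_mono' measurableSet_Ioc fun s hs => ENNReal.ofReal_le_ofReal (hscore hs.1)
    _ ≤ ENNReal.ofReal (H t - (-V 0 + d / 2 * log (2 * π))) :=
        lintegral_Ioc_ofReal_deriv_le hHd hHc hHn
          (fun s hs => le_cgf_sq_norm_add hVc hint hβ hmid (hapos hs)) ht
    _ ≤ _ := by
        refine ENNReal.ofReal_le_ofReal ?_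
        rw [log_div (exp_pos _).ne' hZ.ne', log_exp, log_div hβ.ne' (by positivity)]
        linarith
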